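/- Let G = (A, S) be a parameterized safety game on a complete parameterized arena (all transition languages Δ(v,v') regular), in which every unsafe vertex is a sink, and let v₀ be an initial vertex. If there exists a winning coalition strategy from v₀, then there exists a winning coalition strategy σ from v₀ such that σ(h) = σ(zip(h)) for every history h from v₀, and such that for every history h the infinite word σ(h) is ultimately periodic, i.e. of the form u·v^ω for some finite words u ∈ Σ^* and v ∈ Σ⁺. -/

import Mathlib

/-- The prefix of length `k` of an infinite word `w`. -/
def wordPrefix {A : Type*} (w : ℕ → A) (k : ℕ) : List A := (List.range k).map w

/-- The history `ρ 0, ρ 1, …, ρ j` of a play `ρ`. -/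
def histUpTo {V : Type*} (ρ : ℕ → V) (j : ℕ) : List V := (List.range (j+1)).map ρ

/-- `h` is a history from `v₀`: nonempty, starts at `v₀`, and consecutive vertices
are linked by a nonempty transition language. -/
def IsHist {V A : Type*} (Δ : V → V → Set (List A)) (v₀ : V) (h : List V) : Prop :=
  h ≠ [] ∧ h.head? = some v₀ ∧ List.Chain' (fun u w => (Δ u w).Nonempty) h

/-- Membership of the play `ρ` in the `k`-outcome of the coalition strategy `σ` from `v₀`. -/
def InOutcome {V A : Type*} (Δ : V → V → Set (List A)) (v₀ : V) (σ : List V → ℕ → A)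
    (k : ℕ) (ρ : ℕ → V) : Prop :=
  ρ 0 = v₀ ∧ ∀ j : ℕ, wordPrefix (σ (histUpTo ρ j)) k ∈ Δ (ρ j) (ρ (j+1))

/-- The coalition strategy `σ` is winning from `v₀` for the safe set `S`. -/
def WinningFrom {V A : Type*} (Δ : V → V → Set (List A)) (S : Set V) (v₀ : V)
    (σ : List V → ℕ → A) : Prop :=
  ∀ k : ℕ, 1 ≤ k → ∀ ρ : ℕ → V, InOutcome Δ v₀ σ k ρ → ∀ j : ℕ, ρ j ∈ S

/-- Auxiliary loop-erasure on reversed histories (most recent vertex first). -/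
def zipAux {V : Type*} [DecidableEq V] : List V → List V
  | [] => []
  | v' :: rest =>
    let z := zipAux rest
    if v' ∈ z then z.dropWhile (fun x => decide (x ≠ v')) else v' :: z

/-- The loop-erasure map `zip` on histories. -/
def zip {V : Type*} [DecidableEq V] (h : List V) : List V := (zipAux h.reverse).reverse

/-- All words of the transition languages are nonempty. -/
def NonemptyWords {V A : Type*} (Δ : V → V → Set (List A)) : Prop :=
  ∀ v w : V, ∀ u ∈ Δ v w, u ≠ ([] : List A)

/-- Completeness of the arena. -/
def CompleteArena {V A : Type*} (Δ : V → V → Set (List A)) : Prop :=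
  ∀ v : V, ∀ u : List A, u ≠ [] → ∃ w : V, u ∈ Δ v w

/-- Every unsafe vertex is a sink. -/
def UnsafeSinks {V A : Type*} (Δ : V → V → Set (List A)) (S : Set V) : Prop :=
  ∀ v ∉ S, Δ v v = {u : List A | u ≠ []} ∧ ∀ w : V, w ≠ v → Δ v w = (∅ : Set (List A))

/-- A language of finite words is regular if it is accepted by a DFA with finitely
many states. -/
def IsRegularLang {A : Type*} (L : Set (List A)) : Prop :=
  ∃ (Q : Type) (_ : Fintype Q) (M : DFA A Q), ∀ u : List A, u ∈ M.accepts ↔ u ∈ L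

/-- The strategy `σ` uses the memory set `M`. -/
def UsesMemory {V A : Type*} (Δ : V → V → Set (List A)) (v₀ : V)
    (σ : List V → ℕ → A) (M : Type) : Prop :=
  ∃ (minit : M) (upd : M → V → M) (next : M → V → ℕ → A),
    ∀ h : List V, IsHist Δ v₀ h → σ h = next (h.tail.foldl upd minit) (h.getLastD v₀)

/-- An infinite word is ultimately periodic, i.e. of the form `u · v^ω` for finite
words `u` and `v ≠ []`. -/
def UltPeriodic {A : Type*} (w : ℕ → A) : Prop :=
  ∃ (u v : List A), v ≠ [] ∧ ∀ n : ℕ,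
    w n = (u ++ v).getD (if n < u.length then n else u.length + (n - u.length) % v.length) (w 0)

section LoopErasure

variable {V : Type*} [DecidableEq V]

lemma head?_dropWhile_ne {v : V} {l : List V} (h : v ∈ l) :
    (l.dropWhile (fun x => decide (x ≠ v))).head? = some v := by
  induction l with
  | nil => simp at h
  | cons a l ih =>
    by_cases hav : a = v
    · simp [hav]
    · rw [List.dropWhile_cons_of_pos (by simpa using hav)]
      exact ih (by simpa [Ne.symm hav] using h)

lemma zipAux_nodup (l : List V) : (zipAux l).Nodup := by
  induction l with
  | nil => simp [zipAux]
  | cons a l ih =>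
    simp only [zipAux]
    split_ifs with h
    · exact ih.sublist (List.dropWhile_suffix _).sublist
    · exact List.nodup_cons.2 ⟨h, ih⟩

lemma zipAux_eq_self {l : List V} (h : l.Nodup) : zipAux l = l := by
  induction l with
  | nil => rfl
  | cons a l ih =>
    obtain ⟨ha, hl⟩ := List.nodup_cons.1 h
    simp [zipAux, ih hl, ha]

lemma zip_nodup (h : List V) : (zip h).Nodup := List.nodup_reverse.2 (zipAux_nodup _)

lemma zip_zip (h : List V) : zip (zip h) = zip h := by
  unfold zip
  rw [List.reverse_reverse, zipAux_eq_self (zipAux_nodup _)]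

lemma zip_append_of_notMem {h : List V} {v : V} (hv : v ∉ zip h) :
    zip (h ++ [v]) = zip h ++ [v] := by
  unfold zip at *
  simp [zipAux, List.mem_reverse.not.1 hv]

lemma zip_append_of_mem {h : List V} {v : V} (hv : v ∈ zip h) :
    zip (h ++ [v]) <+: zip h ∧ (zip (h ++ [v])).getLast? = some v := by
  unfold zip at *
  have hv' := List.mem_reverse.1 hv
  have e : zipAux (h ++ [v]).reverse =
      (zipAux h.reverse).dropWhile (fun x => decide (x ≠ v)) := by
    rw [List.reverse_append, List.reverse_singleton, List.singleton_append]
    simp only [zipAux]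
    rw [if_pos hv']
  rw [e]
  exact ⟨List.reverse_prefix.2 (List.dropWhile_suffix _),
    by rw [List.getLast?_reverse, head?_dropWhile_ne hv']⟩

end LoopErasure

lemma wordPrefix_succ {A : Type*} (w : ℕ → A) (k : ℕ) :
    wordPrefix w (k + 1) = wordPrefix w k ++ [w k] := by
  simp [wordPrefix, List.range_succ]

lemma wordPrefix_ne_nil {A : Type*} (w : ℕ → A) {k : ℕ} (hk : 1 ≤ k) :
    wordPrefix w k ≠ [] := by
  simp [wordPrefix]; omega

lemma histUpTo_succ {V : Type*} (ρ : ℕ → V) (j : ℕ) :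
    histUpTo ρ (j + 1) = histUpTo ρ j ++ [ρ (j + 1)] := by
  simp [histUpTo, List.range_succ]

/-- The finite sequence `l` starts at `v₀` and each of its steps is possible when `k` agents
follow `σ`. -/
def IsConsistent {V A : Type*} (Δ : V → V → Set (List A)) (v₀ : V) (σ : List V → ℕ → A)
    (k : ℕ) (l : List V) : Prop :=
  l[0]? = some v₀ ∧ ∀ j u w, l[j]? = some u → l[j + 1]? = some w →
    wordPrefix (σ (l.take (j + 1))) k ∈ Δ u w

section Consistent

variable {V A : Type*} {Δ : V → V → Set (List A)} {S : Set V} {v₀ : V} {σ : List V → ℕ → A}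
  {k : ℕ}

lemma IsConsistent.of_prefix {l m : List V} (hl : IsConsistent Δ v₀ σ k l) (hm : m <+: l)
    (hne : m ≠ []) : IsConsistent Δ v₀ σ k m := by
  obtain ⟨t, rfl⟩ := hm
  have hpos := List.length_pos_iff.2 hne
  refine ⟨by rw [← hl.1, List.getElem?_append_left hpos], fun j u w hu hw => ?_⟩
  have hj := (List.getElem?_eq_some_iff.1 hw).1
  have := hl.2 j u w (by rwa [List.getElem?_append_left (by omega)])
    (by rwa [List.getElem?_append_left hj])
  rwa [List.take_append_of_le_length (by omega)] at this

lemma IsConsistent.append {l : List V} {u w : V} (hl : IsConsistent Δ v₀ σ k l)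
    (hu : l.getLast? = some u) (hw : wordPrefix (σ l) k ∈ Δ u w) :
    IsConsistent Δ v₀ σ k (l ++ [w]) := by
  have hpos : 0 < l.length := (List.getElem?_eq_some_iff.1 hl.1).1
  refine ⟨by rw [← hl.1, List.getElem?_append_left hpos], fun j a b ha hb => ?_⟩
  have hj := (List.getElem?_eq_some_iff.1 hb).1
  simp only [List.length_append, List.length_singleton] at hj
  rw [List.take_append_of_le_length (by omega)]
  rw [List.getElem?_append_left (by omega)] at ha
  by_cases hlt : j + 1 < l.length
  · exact hl.2 j a b ha (by rwa [List.getElem?_append_left hlt] at hb)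
  · have hjl : j + 1 = l.length := by omega
    rw [hjl, List.take_length]
    rw [hjl, List.getElem?_concat_length] at hb
    rw [List.getLast?_eq_getElem?, ← hjl, Nat.add_sub_cancel, ha] at hu
    cases hu; cases hb; exact hw

lemma InOutcome.isConsistent_zip [DecidableEq V] {ρ : ℕ → V}
    (hρ : InOutcome Δ v₀ (fun h => σ (zip h)) k ρ) (j : ℕ) :
    IsConsistent Δ v₀ σ k (zip (histUpTo ρ j)) ∧
      (zip (histUpTo ρ j)).getLast? = some (ρ j) := by
  induction j with
  | zero => simp [histUpTo, zip, zipAux, IsConsistent, hρ.1]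
  | succ j ih =>
    rw [histUpTo_succ]
    by_cases hv : ρ (j + 1) ∈ zip (histUpTo ρ j)
    · obtain ⟨hp, hlast⟩ := zip_append_of_mem hv
      exact ⟨ih.1.of_prefix hp (by rintro h; simp [h] at hlast), hlast⟩
    · rw [zip_append_of_notMem hv]
      exact ⟨ih.1.append ih.2 (hρ.2 j), by simp⟩

/-- A consistent sequence ending in an unsafe sink extends to an infinite play. -/
lemma WinningFrom.mem_of_isConsistent (hσ : WinningFrom Δ S v₀ σ) (hsink : UnsafeSinks Δ S)
    (hk : 1 ≤ k) {l : List V} {v : V} (hl : IsConsistent Δ v₀ σ k l)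
    (hv : l.getLast? = some v) : v ∈ S := by
  by_contra hvS
  have hpos : 0 < l.length := (List.getElem?_eq_some_iff.1 hl.1).1
  have hget : ∀ j < l.length, l[j]? = some (l.getD j v) := fun j hj => by simp [hj]
  have hout : ∀ j, l.length ≤ j + 1 → l.getD j v = v := by
    intro j hj
    rw [List.getLast?_eq_getElem?] at hv
    rcases hj.eq_or_lt with h | h
    · rw [h, Nat.add_sub_cancel] at hv
      rw [List.getD_eq_getElem?_getD, hv, Option.getD_some]
    · exact List.getD_eq_default _ _ (by omega)
  refine hvS ?_
  rw [← hout l.length (by omega)]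
  refine hσ k hk (fun j => l.getD j v) ⟨?_, fun j => ?_⟩ _
  · have := hget 0 hpos
    rw [hl.1] at this
    exact (Option.some.inj this).symm
  · by_cases hj : j + 1 < l.length
    · have htake : histUpTo (fun j => l.getD j v) j = l.take (j + 1) := by
        apply List.ext_getElem
        · simp [histUpTo]; omega
        · intro n h₁ h₂
          simp only [List.length_take] at h₂
          have : n < l.length := by omega
          simp [histUpTo, this]
      rw [htake]
      exact hl.2 j _ _ (hget j (by omega)) (hget (j + 1) hj)
    · simp only [hout j (by omega), hout (j + 1) (by omega), (hsink v hvS).1]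
      exact wordPrefix_ne_nil _ hk

lemma WinningFrom.comp_zip [DecidableEq V] (hσ : WinningFrom Δ S v₀ σ)
    (hsink : UnsafeSinks Δ S) : WinningFrom Δ S v₀ (fun h => σ (zip h)) :=
  fun _ hk _ hρ j =>
    hσ.mem_of_isConsistent hsink hk (hρ.isConsistent_zip j).1 (hρ.isConsistent_zip j).2

end Consistent

/-- The index map that folds `ℕ` onto a lasso with stem `[0, i)` and loop `[i, i + d)`. -/
def lassoIndex (i d n : ℕ) : ℕ := if n < i then n else i + (n - i) % d

lemma lassoIndex_of_lt {i n : ℕ} (d : ℕ) (h : n < i) : lassoIndex i d n = n := if_pos h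

lemma lassoIndex_add (i d m : ℕ) : lassoIndex i d (i + m) = i + m % d := by
  simp [lassoIndex]

lemma lassoIndex_succ {i d : ℕ} (hd : 0 < d) (n : ℕ) :
    lassoIndex i d (n + 1) =
      if lassoIndex i d n + 1 = i + d then i else lassoIndex i d n + 1 := by
  rcases lt_trichotomy (n + 1) i with h | rfl | h
  · rw [lassoIndex_of_lt d h, lassoIndex_of_lt d (by omega), if_neg (by omega)]
  · rw [lassoIndex_of_lt d n.lt_succ_self, if_neg (by omega)]
    simpa using lassoIndex_add (n + 1) d 0
  · obtain ⟨m, rfl⟩ : ∃ m, n = i + m := ⟨n - i, by omega⟩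
    have hm := Nat.mod_lt m hd
    have e : (m + 1) % d = (m % d + 1) % d := (Nat.mod_add_mod m d 1).symm
    rw [Nat.add_assoc, lassoIndex_add, lassoIndex_add, e]
    split_ifs with h'
    · rw [show m % d + 1 = d by omega, Nat.mod_self, Nat.add_zero]
    · rw [Nat.mod_eq_of_lt (by omega), Nat.add_assoc]

lemma one_le_lassoIndex {i d n : ℕ} (hi : 1 ≤ i) (hn : 1 ≤ n) : 1 ≤ lassoIndex i d n := by
  unfold lassoIndex; split_ifs <;> omega

lemma ultPeriodic_lasso {A : Type*} (w : ℕ → A) (i : ℕ) {d : ℕ} (hd : 0 < d) :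
    UltPeriodic (fun n => w (lassoIndex i d n)) := by
  refine ⟨(List.range i).map w, (List.range d).map (fun n => w (i + n)), by simp; omega,
    fun n => ?_⟩
  simp only [List.length_map, List.length_range]
  rcases lt_or_ge n i with h | h
  · rw [if_pos h, lassoIndex_of_lt d h]
    simp [List.getD_eq_getElem?_getD, List.getElem?_append, h]
  · obtain ⟨m, rfl⟩ := Nat.exists_eq_add_of_le h
    rw [if_neg (by omega), lassoIndex_add]
    simp [List.getD_eq_getElem?_getD, Nat.mod_lt _ hd]

lemma DFA.eval_wordPrefix_lasso {A Q : Type*} (M : DFA A Q) (w : ℕ → A) {i d : ℕ} (hd : 0 < d)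
    (hM : M.eval (wordPrefix w i) = M.eval (wordPrefix w (i + d))) (k : ℕ) :
    M.eval (wordPrefix (fun n => w (lassoIndex i d n)) k) =
      M.eval (wordPrefix w (lassoIndex i d k)) := by
  induction k with
  | zero =>
    have : lassoIndex i d 0 = 0 := by unfold lassoIndex; split_ifs <;> simp; omega
    simp [this, wordPrefix]
  | succ k ih =>
    rw [wordPrefix_succ, DFA.eval_append_singleton, ih, ← DFA.eval_append_singleton,
      ← wordPrefix_succ, lassoIndex_succ hd]
    split_ifs with h
    · rw [h, hM]
    · rfl

/-- Finitely many infinite words can be folded simultaneously onto a common lasso, preserving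
membership of their prefixes in finitely many regular languages. -/
lemma exists_lasso {A ι κ : Type*} [Finite ι] [Finite κ] (w : ι → ℕ → A) (L : κ → Set (List A))
    (hL : ∀ c, IsRegularLang (L c)) :
    ∃ i d, 1 ≤ i ∧ 0 < d ∧ ∀ x c k, wordPrefix (fun n => w x (lassoIndex i d n)) k ∈ L c ↔
      wordPrefix (w x) (lassoIndex i d k) ∈ L c := by
  choose Q hQ M hM using hL
  have : ∀ c, Finite (Q c) := fun c => @Finite.of_fintype _ (hQ c)
  obtain ⟨a, b, hab, he⟩ := Finite.exists_ne_map_eq_of_infinite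
    (fun (k : ℕ) (x : ι) (c : κ) => (M c).eval (wordPrefix (w x) (k + 1)))
  wlog hlt : a < b generalizing a b
  · exact this b a hab.symm he.symm (by omega)
  have hd : 0 < b - a := by omega
  refine ⟨a + 1, b - a, by omega, hd, fun x c k => ?_⟩
  have hx : (M c).eval (wordPrefix (w x) (a + 1)) =
      (M c).eval (wordPrefix (w x) (a + 1 + (b - a))) := by
    rw [show a + 1 + (b - a) = b + 1 by omega]
    exact congrFun (congrFun he x) c
  rw [← hM, ← hM, DFA.mem_accepts, DFA.mem_accepts, (M c).eval_wordPrefix_lasso (w x) hd hx]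

/-- if a winning coalition strategy from `v₀` exists, then there is a
winning coalition strategy `σ` from `v₀` that factors through loop-erasure and such
that all the infinite words `σ h` are ultimately periodic. -/
theorem stmt5 {V A : Type} [Fintype V] [DecidableEq V] [Fintype A]
    (Δ : V → V → Set (List A)) (S : Set V) (v₀ : V)
    (hreg : ∀ v w : V, IsRegularLang (Δ v w))
    (hne : NonemptyWords Δ)
    (hcomp : CompleteArena Δ)
    (hsink : UnsafeSinks Δ S)
    (hwin : ∃ σ : List V → ℕ → A, WinningFrom Δ S v₀ σ) :
    ∃ σ : List V → ℕ → A, WinningFrom Δ S v₀ σ ∧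
      (∀ h : List V, IsHist Δ v₀ h → σ h = σ (zip h)) ∧
      (∀ h : List V, IsHist Δ v₀ h → UltPeriodic (σ h)) := by
  obtain ⟨σ, hσ⟩ := hwin
  obtain ⟨i, d, hi, hd, hmem⟩ := exists_lasso (fun l : {l : List V // l.Nodup} => σ l)
    (fun c : V × V => Δ c.1 c.2) (fun c => hreg c.1 c.2)
  refine ⟨fun h n => σ (zip h) (lassoIndex i d n), fun k hk ρ hρ => ?_, fun h _ => ?_,
    fun h _ => ultPeriodic_lasso _ i hd⟩
  · exact hσ.comp_zip hsink _ (one_le_lassoIndex hi hk) ρ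
      ⟨hρ.1, fun j => (hmem ⟨_, zip_nodup _⟩ (ρ j, ρ (j + 1)) k).1 (hρ.2 j)⟩
  · simp only [zip_zip]
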